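/- arXiv:1508.06653 — 2 statements merged into one kernel-verified Lean document; each statement's English description precedes it below -/
import Mathlib

section
/- Under Condition (C) (nQ₁(n) ~ σQ₂(n) for some σ ∈ (0,∞)), for any s₁, s₂ ∈ (0,1) and any integer sequence m = m(n) with 1 ≤ m(n) ≪ n, one has lim_{n→∞} E[s₁^{Z₁(m,n)} s₂^{Z₂(m,n)} | Z(n) ≠ 0, Z(0)=e₂] = s₂. -/
open MeasureTheory Filter Topology

/-- `a(n) ~ b(n)` : the ratio tends to `1` as `n → ∞`. -/
def Asymp (f g : ℕ → ℝ) : Prop :=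
  Filter.Tendsto (fun n => f n / g n) Filter.atTop (nhds 1)

/-- A critical decomposable two-type Galton–Watson process together with its
reduced process.  `P1` is the law of the process started from one particle of
type 1 (`Z(0) = e₁`), `P2` the law started from one particle of type 2
(`Z(0) = e₂`).  `Z1 n`/`Z2 n` are the numbers of particles of types 1 and 2 at
time `n`; `R1 m n`/`R2 m n` are the numbers of particles of types 1 and 2 alive
at time `m` having descendants at time `n` (the reduced process). -/
structure GWSetup where
  (Ω : Type)
  [mΩ : MeasurableSpace Ω]
  (P1 : Measure Ω)
  (P2 : Measure Ω)
  (hprob1 : IsProbabilityMeasure P1)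
  (hprob2 : IsProbabilityMeasure P2)
  (Z1 : ℕ → Ω → ℕ)
  (Z2 : ℕ → Ω → ℕ)
  (R1 : ℕ → ℕ → Ω → ℕ)
  (R2 : ℕ → ℕ → Ω → ℕ)
  (mZ1 : ∀ n, Measurable (Z1 n))
  (mZ2 : ∀ n, Measurable (Z2 n))
  (mR1 : ∀ m n, Measurable (R1 m n))
  (mR2 : ∀ m n, Measurable (R2 m n))
  (α1 : ℝ)
  (α2 : ℝ)
  (A21 : ℝ)
  (L1 : ℝ → ℝ)
  (L2 : ℝ → ℝ)
  (ρ : ℝ → ℝ → ℝ)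
  (hα1 : 0 < α1 ∧ α1 ≤ 1)
  (hα2 : 0 < α2 ∧ α2 ≤ 1)
  (hA21 : 0 < A21)
  -- initial states
  (hinit1 : ∀ᵐ ω ∂P1, Z1 0 ω = 1 ∧ Z2 0 ω = 0)
  (hinit2 : ∀ᵐ ω ∂P2, Z1 0 ω = 0 ∧ Z2 0 ω = 1)
  -- type-1 particles produce only type-1 particles
  (hdecomp : ∀ n, ∀ᵐ ω ∂P1, Z2 n ω = 0)
  -- criticality
  (hcrit1 : (∫ ω, (Z1 1 ω : ℝ) ∂P1) = 1)
  (hcrit2 : (∫ ω, (Z2 1 ω : ℝ) ∂P2) = 1)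
  -- mean number of type-1 children of a type-2 particle
  (hmean21 : (∫ ω, (Z1 1 ω : ℝ) ∂P2) = A21)
  -- assumption (F1)
  (hF1 : ∀ s : ℝ, 0 ≤ s → s < 1 →
    (∫ ω, s ^ Z1 1 ω ∂P1) = s + (1 - s) ^ (1 + α1) * L1 (1 - s))
  -- assumption (F2)
  (hF2 : ∀ s1 s2 : ℝ, 0 ≤ s1 → s1 ≤ 1 → 0 ≤ s2 → s2 < 1 →
    (∫ ω, s1 ^ Z1 1 ω * s2 ^ Z2 1 ω ∂P2) =
      s2 + (1 - s2) ^ (1 + α2) * L2 (1 - s2) - (A21 - ρ s1 s2) * (1 - s1))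
  -- `L1`, `L2` are slowly varying at `0`
  (hL1 : ∀ c : ℝ, 0 < c →
    Filter.Tendsto (fun x => L1 (c * x) / L1 x) (nhdsWithin 0 (Set.Ioi 0)) (nhds 1))
  (hL2 : ∀ c : ℝ, 0 < c →
    Filter.Tendsto (fun x => L2 (c * x) / L2 x) (nhdsWithin 0 (Set.Ioi 0)) (nhds 1))
  -- `ρ(s₁,s₂) → 0` as `s₁ s₂ ↑ 1`
  (hρ : ∀ ε : ℝ, 0 < ε → ∃ δ : ℝ, 0 < δ ∧ ∀ s1 s2 : ℝ,
    0 ≤ s1 → s1 ≤ 1 → 0 ≤ s2 → s2 ≤ 1 → 1 - δ < s1 * s2 → |ρ s1 s2| < ε)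
  -- branching (semigroup) property at the level of generating functions
  (hbranch1 : ∀ m n : ℕ, ∀ s : ℝ, 0 ≤ s → s ≤ 1 →
    (∫ ω, s ^ Z1 (m + n) ω ∂P1) = ∫ ω, (∫ ω', s ^ Z1 n ω' ∂P1) ^ Z1 m ω ∂P1)
  (hbranch2 : ∀ m n : ℕ, ∀ s1 s2 : ℝ, 0 ≤ s1 → s1 ≤ 1 → 0 ≤ s2 → s2 ≤ 1 →
    (∫ ω, s1 ^ Z1 (m + n) ω * s2 ^ Z2 (m + n) ω ∂P2) =
      ∫ ω, (∫ ω', s1 ^ Z1 n ω' ∂P1) ^ Z1 m ω *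
        (∫ ω', s1 ^ Z1 n ω' * s2 ^ Z2 n ω' ∂P2) ^ Z2 m ω ∂P2)
  -- the reduced process vanishes on the extinction event
  (hext : ∀ m n : ℕ, ∀ᵐ ω ∂P2,
    (Z1 n ω = 0 ∧ Z2 n ω = 0) → (R1 m n ω = 0 ∧ R2 m n ω = 0))
  -- the generating function of the reduced process (conditioning on `Z(m)`)
  (hreduced : ∀ m n : ℕ, m ≤ n → ∀ s1 s2 : ℝ, 0 ≤ s1 → s1 ≤ 1 → 0 ≤ s2 → s2 ≤ 1 →
    (∫ ω, s1 ^ R1 m n ω * s2 ^ R2 m n ω ∂P2) =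
      ∫ ω, (1 - (1 - s1) * (P1 {ω' | Z1 (n - m) ω' ≠ 0}).toReal) ^ Z1 m ω *
        (1 - (1 - s2) *
          (P2 {ω' | Z1 (n - m) ω' ≠ 0 ∨ Z2 (n - m) ω' ≠ 0}).toReal) ^ Z2 m ω ∂P2)

namespace GWSetup

variable (S : GWSetup)

/-- The survival event `{Z(n) ≠ 0}` (under the law `P2`). -/
def surv (n : ℕ) : Set S.Ω := {ω | S.Z1 n ω ≠ 0 ∨ S.Z2 n ω ≠ 0}

/-- `Q₁(n) = P(Z₁(n) > 0 | Z(0) = e₁)`. -/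
noncomputable def Q1 (n : ℕ) : ℝ := (S.P1 {ω | S.Z1 n ω ≠ 0}).toReal

/-- `Q₂(n) = P(Z₂(n) > 0 | Z(0) = e₂)`. -/
noncomputable def Q2 (n : ℕ) : ℝ := (S.P2 {ω | S.Z2 n ω ≠ 0}).toReal

/-- `Q₂₁(n) = P(Z(n) ≠ 0 | Z(0) = e₂)`. -/
noncomputable def Q21 (n : ℕ) : ℝ := (S.P2 (S.surv n)).toReal

/-- `F₁(n; s) = E[s^{Z₁(n)} | Z(0) = e₁]`. -/
noncomputable def F1 (n : ℕ) (s : ℝ) : ℝ := ∫ ω, s ^ S.Z1 n ω ∂S.P1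

/-- `F₂₁(n; s₁, s₂) = E[s₁^{Z₁(n)} s₂^{Z₂(n)} | Z(0) = e₂]`. -/
noncomputable def F21 (n : ℕ) (s1 s2 : ℝ) : ℝ :=
  ∫ ω, s1 ^ S.Z1 n ω * s2 ^ S.Z2 n ω ∂S.P2

/-- `Q₁(n; s) = 1 - F₁(n; s)`. -/
noncomputable def Q1s (n : ℕ) (s : ℝ) : ℝ := 1 - S.F1 n s

/-- `Q₂(n; s) = 1 - E[s^{Z₂(n)} | Z(0) = e₂]`. -/
noncomputable def Q2s (n : ℕ) (s : ℝ) : ℝ := 1 - S.F21 n 1 s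

/-- `Q₂₁(n; s₁, s₂) = 1 - F₂₁(n; s₁, s₂)`. -/
noncomputable def Q21s (n : ℕ) (s1 s2 : ℝ) : ℝ := 1 - S.F21 n s1 s2

/-- The conditional expectation
`E[f(Z₁(m,n), Z₂(m,n)) | Z(n) ≠ 0, Z(0) = e₂]` for the reduced process. -/
noncomputable def Ered (m n : ℕ) (f : ℕ → ℕ → ℝ) : ℝ :=
  (∫ ω in S.surv n, f (S.R1 m n ω) (S.R2 m n ω) ∂S.P2) / S.Q21 n

/-- The conditional probability `P(E | Z(n) ≠ 0, Z(0) = e₂)`. -/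
noncomputable def Pred (n : ℕ) (E : Set S.Ω) : ℝ :=
  (S.P2 (E ∩ S.surv n)).toReal / S.Q21 n

/-- The birth time `β_n` of the most recent common ancestor of the population
alive at time `n`:  `β_n = max {m < n : Z₁(m,n) + Z₂(m,n) = 1}`. -/
noncomputable def beta (n : ℕ) (ω : S.Ω) : ℕ :=
  sSup {m | m < n ∧ S.R1 m n ω + S.R2 m n ω = 1}

/-- The type `T_n` of the most recent common ancestor: the `i ∈ {1,2}` with
`Z_i(β_n, n) = 1`. -/
noncomputable def mrcaType (n : ℕ) (ω : S.Ω) : ℕ :=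
  if S.R2 (S.beta n ω) n ω = 1 then 2 else 1

/-- Condition (A): `n Q₁(n) = o(Q₂(n))`. -/
def CondA : Prop :=
  Filter.Tendsto (fun n : ℕ => (n : ℝ) * S.Q1 n / S.Q2 n) Filter.atTop (nhds 0)

/-- Condition (B): `Q₂(n) = o(n Q₁(n))`. -/
def CondB : Prop :=
  Filter.Tendsto (fun n : ℕ => S.Q2 n / ((n : ℝ) * S.Q1 n)) Filter.atTop (nhds 0)

/-- Condition (C): `n Q₁(n) ~ σ Q₂(n)`. -/
def CondC (σ : ℝ) : Prop := Asymp (fun n : ℕ => (n : ℝ) * S.Q1 n) (fun n => σ * S.Q2 n)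

/-- `h*` is an integer-valued function with
`(α₁ A₂₁ / (1 - α₁)) h*(n) Q₁(h*(n)) ~ Q₂(n)`. -/
def IsHStar (h : ℕ → ℕ) : Prop :=
  Asymp (fun n : ℕ => S.α1 * S.A21 / (1 - S.α1) * (h n : ℝ) * S.Q1 (h n)) S.Q2

/-- `g*` is an integer-valued function with `Q₂(g*(n)) ~ Q₂₁(n)`. -/
def IsGStar (g : ℕ → ℕ) : Prop := Asymp (fun n => S.Q2 (g n)) S.Q21

end GWSetup

section Analysis

/-- A sequence with multiplicative decrements at least `H` decays exponentially. -/
lemma le_mul_exp_of_decrement {q : ℕ → ℝ} {h : ℝ → ℝ} (hq : ∀ n, 0 < q n)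
    (hrec : ∀ n, q (n + 1) = q n * (1 - h (q n))) {H : ℝ} (n k : ℕ)
    (hH : ∀ j, j < n + k → H ≤ h (q j)) :
    q (n + k) ≤ q n * Real.exp (-(k * H)) := by
  induction k with
  | zero => simp
  | succ k ih =>
    have hstep : 1 - h (q (n + k)) ≤ Real.exp (-H) := by
      have := Real.add_one_le_exp (-H)
      have := hH (n + k) (by omega)
      linarith
    calc q (n + (k + 1)) = q (n + k) * (1 - h (q (n + k))) := hrec (n + k)
      _ ≤ q (n + k) * Real.exp (-H) := mul_le_mul_of_nonneg_left hstep (hq _).le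
      _ ≤ q n * Real.exp (-(k * H)) * Real.exp (-H) :=
        mul_le_mul_of_nonneg_right (ih fun j hj => hH j (by omega)) (Real.exp_pos _).le
      _ = q n * Real.exp (-(((k + 1 : ℕ) : ℝ) * H)) := by
        rw [mul_assoc, ← Real.exp_add]; push_cast; ring_nf

/-- If `q (n + 1) = q n * (1 - h (q n))` with `h` monotone and regularly varying at `0` with
positive index, then `q n → 0` and `n * h (q n)` is bounded. -/
lemma tendsto_zero_and_bounded_of_decrement {q : ℕ → ℝ} {h : ℝ → ℝ} {α : ℝ} (hα : 0 < α)
    (hq : ∀ n, 0 < q n) (hq1 : ∀ n, q n ≤ 1) (hrec : ∀ n, q (n + 1) = q n * (1 - h (q n)))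
    (hmono : ∀ x y, 0 < x → x ≤ y → y ≤ 1 → h x ≤ h y)
    (hpos : ∀ x, 0 < x → x ≤ 1 → 0 < h x)
    (hreg : ∀ c, 0 < c → Tendsto (fun x => h (c * x) / h x) (𝓝[>] 0) (𝓝 (c ^ α))) :
    Tendsto q atTop (𝓝 0) ∧ ∃ U : ℝ, ∀ n : ℕ, n * h (q n) ≤ U := by
  have hanti : Antitone q := antitone_nat_of_succ_le fun n => by
    rw [hrec]
    nlinarith [mul_pos (hq n) (hpos _ (hq n) (hq1 n))]
  have hlim : Tendsto q atTop (𝓝 0) := by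
    refine tendsto_order.2 ⟨fun a ha => .of_forall fun n => ha.trans (hq n), fun ε hε => ?_⟩
    by_contra hcon
    have hge : ∀ n, ε ≤ q n := by
      intro n
      by_contra! hlt
      exact hcon (eventually_atTop.2 ⟨n, fun k hk => (hanti hk).trans_lt hlt⟩)
    have hH := hpos ε hε ((hge 0).trans (hq1 0))
    have hexp : ∀ k : ℕ, ε ≤ q 0 * Real.exp (-(k * h ε)) := fun k =>
      (hge (0 + k)).trans <| le_mul_exp_of_decrement hq hrec 0 k
        fun j _ => hmono _ _ hε (hge j) (hq1 j)
    have hto : Tendsto (fun k : ℕ => q 0 * Real.exp (-(k * h ε))) atTop (𝓝 (q 0 * 0)) :=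
      (Real.tendsto_exp_neg_atTop_nhds_zero.comp
        (tendsto_natCast_atTop_atTop.atTop_mul_const hH)).const_mul _
    rw [mul_zero] at hto
    exact hε.not_ge (ge_of_tendsto' hto hexp)
  refine ⟨hlim, ?_⟩
  obtain ⟨c, hc0, hcα⟩ : ∃ c : ℝ, 0 < c ∧ c ^ α < 1 / 4 :=
    ⟨(1 / 8) ^ (1 / α), by positivity, by
      rw [← Real.rpow_mul (by norm_num)]
      rw [one_div_mul_cancel hα.ne']; norm_num⟩
  have hlim' : Tendsto q atTop (𝓝[>] 0) :=
    tendsto_nhdsWithin_iff.2 ⟨hlim, .of_forall hq⟩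
  obtain ⟨N, hN⟩ := eventually_atTop.1 (hlim'.eventually ((hreg c hc0).eventually_lt_const hcα))
  set K : ℝ := -Real.log c with hK
  have hhalf : ∀ n, 2 * (N + 1) ≤ n →
      n * h (q n) ≤ 2 * K ∨ n * h (q n) ≤ (n / 2 : ℕ) * h (q (n / 2)) := by
    intro n hn
    obtain ⟨j, hj⟩ : ∃ j, j = n / 2 := ⟨_, rfl⟩
    obtain ⟨k, hk⟩ : ∃ k, n = j + k := ⟨n - j, by omega⟩
    rw [← hj]
    have hhn := hpos _ (hq n) (hq1 n)
    have hnk : (n : ℝ) ≤ 2 * k := by exact_mod_cast (by omega : n ≤ 2 * k)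
    have hnj : (n : ℝ) ≤ 4 * j := by exact_mod_cast (by omega : n ≤ 4 * j)
    rcases le_total (k * h (q n)) K with hle | hge
    · left; nlinarith
    · right
      have hqn : q n ≤ c * q j := by
        have h1 : q n ≤ q j * Real.exp (-(k * h (q n))) := by
          conv_lhs => rw [hk]
          exact le_mul_exp_of_decrement hq hrec j k
            fun i hi => hmono _ _ (hq n) (hanti (by omega)) (hq1 i)
        have h2 : Real.exp (-(k * h (q n))) ≤ c := by
          rw [← Real.exp_log hc0]; exact Real.exp_le_exp.2 (by linarith)
        nlinarith [hq j]
      have hhj := hpos _ (hq j) (hq1 j)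
      have hratio := hN j (by omega)
      rw [div_lt_iff₀ hhj] at hratio
      have hc1 : c * q j ≤ 1 := by
        have : c ≤ 1 := by
          by_contra! hc1
          have := Real.one_lt_rpow hc1 hα
          linarith
        nlinarith [hq j, hq1 j]
      have := hmono _ _ (hq n) hqn hc1
      calc n * h (q n) ≤ n * (1 / 4 * h (q j)) :=
            mul_le_mul_of_nonneg_left (by linarith) (Nat.cast_nonneg _)
        _ ≤ j * h (q j) := by nlinarith
  refine ⟨max (2 * K) ((2 * (N + 1) : ℕ) * h (q 0)), fun n => ?_⟩
  induction n using Nat.strong_induction_on with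
  | _ n ih =>
    rcases lt_or_ge n (2 * (N + 1)) with hn | hn
    · refine le_max_of_le_right (mul_le_mul (by exact_mod_cast hn.le)
        (hmono _ _ (hq n) (hanti (Nat.zero_le n)) (hq1 0)) (hpos _ (hq n) (hq1 n)).le
        (Nat.cast_nonneg _))
    · rcases hhalf n hn with hle | hle
      · exact le_max_of_le_left hle
      · exact hle.trans (ih _ (by omega))

end Analysis

section GeneratingFunctions

variable {Ω : Type*} [MeasurableSpace Ω] {μ : Measure Ω} [IsProbabilityMeasure μ]
  {X Y : Ω → ℕ} {s t s' t' : ℝ}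

lemma integrable_pow_mul_pow (hX : Measurable X) (hY : Measurable Y)
    (hs : s ∈ Set.Icc (0 : ℝ) 1) (ht : t ∈ Set.Icc (0 : ℝ) 1) :
    Integrable (fun ω => s ^ X ω * t ^ Y ω) μ := by
  refine Integrable.of_bound (C := 1) (Measurable.aestronglyMeasurable ?_)
    (.of_forall fun ω => ?_)
  · exact ((measurable_from_nat (f := fun k => s ^ k)).comp hX).mul
      ((measurable_from_nat (f := fun k => t ^ k)).comp hY)
  · have h1 := pow_nonneg hs.1 (X ω)
    have h2 := pow_nonneg ht.1 (Y ω)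
    rw [Real.norm_of_nonneg (mul_nonneg h1 h2)]
    exact mul_le_one₀ (pow_le_one₀ hs.1 hs.2) h2 (pow_le_one₀ ht.1 ht.2)

lemma integral_pow_mul_pow_mono (hX : Measurable X) (hY : Measurable Y)
    (hs : 0 ≤ s) (hss : s ≤ s') (hs' : s' ≤ 1) (ht : 0 ≤ t) (htt : t ≤ t') (ht' : t' ≤ 1) :
    ∫ ω, s ^ X ω * t ^ Y ω ∂μ ≤ ∫ ω, s' ^ X ω * t' ^ Y ω ∂μ :=
  integral_mono (integrable_pow_mul_pow hX hY ⟨hs, hss.trans hs'⟩ ⟨ht, htt.trans ht'⟩)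
    (integrable_pow_mul_pow hX hY ⟨hs.trans hss, hs'⟩ ⟨ht.trans htt, ht'⟩) fun _ =>
    mul_le_mul (pow_le_pow_left₀ hs hss _) (pow_le_pow_left₀ ht htt _) (pow_nonneg ht _)
      (pow_nonneg (hs.trans hss) _)

lemma integral_pow_mul_pow_mem_Icc (hX : Measurable X) (hY : Measurable Y)
    (hs : s ∈ Set.Icc (0 : ℝ) 1) (ht : t ∈ Set.Icc (0 : ℝ) 1) :
    ∫ ω, s ^ X ω * t ^ Y ω ∂μ ∈ Set.Icc (0 : ℝ) 1 :=
  ⟨integral_nonneg fun _ => mul_nonneg (pow_nonneg hs.1 _) (pow_nonneg ht.1 _), by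
    simpa using integral_pow_mul_pow_mono (μ := μ) hX hY hs.1 hs.2 le_rfl ht.1 ht.2 le_rfl⟩

/-- `1 - xy ≤ (1 - x) + (1 - y)` for generating functions. -/
lemma one_sub_integral_pow_mul_pow_le (hX : Measurable X) (hY : Measurable Y)
    (hs : s ∈ Set.Icc (0 : ℝ) 1) (ht : t ∈ Set.Icc (0 : ℝ) 1) :
    1 - ∫ ω, s ^ X ω * t ^ Y ω ∂μ ≤
      (1 - ∫ ω, s ^ X ω * 1 ^ Y ω ∂μ) + (1 - ∫ ω, 1 ^ X ω * t ^ Y ω ∂μ) := by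
  have hone : (1 : ℝ) ∈ Set.Icc (0 : ℝ) 1 := by simp
  have h1 := integrable_pow_mul_pow (μ := μ) hX hY hs hone
  have h2 := integrable_pow_mul_pow (μ := μ) hX hY hone ht
  have h3 := integrable_pow_mul_pow (μ := μ) hX hY hs ht
  have hmono : ∫ ω, (s ^ X ω * 1 ^ Y ω + 1 ^ X ω * t ^ Y ω) ∂μ ≤
      ∫ ω, (1 + s ^ X ω * t ^ Y ω) ∂μ :=
    integral_mono (h1.add h2) ((integrable_const 1).add h3) fun ω => by
      have := pow_le_one₀ (n := X ω) hs.1 hs.2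
      have := pow_le_one₀ (n := Y ω) ht.1 ht.2
      simp only [one_pow, mul_one, one_mul]
      nlinarith
  rw [integral_add h1 h2, integral_add (integrable_const 1) h3] at hmono
  simp only [integral_const, probReal_univ, smul_eq_mul, mul_one] at hmono
  linarith

/-- Bernoulli's inequality for generating functions. -/
lemma one_sub_integral_pow_mul_pow_le_mean (hX : Measurable X) (hY : Measurable Y)
    (hXi : Integrable (fun ω => (X ω : ℝ)) μ) (hYi : Integrable (fun ω => (Y ω : ℝ)) μ)
    (hs : s ∈ Set.Icc (0 : ℝ) 1) (ht : t ∈ Set.Icc (0 : ℝ) 1) :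
    1 - ∫ ω, s ^ X ω * t ^ Y ω ∂μ ≤
      (1 - s) * ∫ ω, (X ω : ℝ) ∂μ + (1 - t) * ∫ ω, (Y ω : ℝ) ∂μ := by
  have hmono : ∫ ω, 1 ∂μ ≤ ∫ ω, (s ^ X ω * t ^ Y ω + ((1 - s) * X ω + (1 - t) * Y ω)) ∂μ :=
    integral_mono (integrable_const 1) ((integrable_pow_mul_pow hX hY hs ht).add
      ((hXi.const_mul _).add (hYi.const_mul _))) fun ω => by
      have hb : ∀ {x : ℝ} (k : ℕ), x ∈ Set.Icc (0 : ℝ) 1 → 1 - k * (1 - x) ≤ x ^ k :=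
        fun {x} k hx => by
          have := one_add_mul_le_pow (a := x - 1) (by linarith [hx.1]) k
          rw [add_sub_cancel] at this
          linarith
      have h1 := hb (X ω) hs
      have h2 := hb (Y ω) ht
      have := pow_le_one₀ (n := X ω) hs.1 hs.2
      have := pow_le_one₀ (n := Y ω) ht.1 ht.2
      simp only
      nlinarith
  have hlin : ∫ ω, ((1 - s) * X ω + (1 - t) * Y ω) ∂μ =
      (1 - s) * ∫ ω, (X ω : ℝ) ∂μ + (1 - t) * ∫ ω, (Y ω : ℝ) ∂μ := by
    rw [integral_add (hXi.const_mul _) (hYi.const_mul _), integral_const_mul,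
      integral_const_mul]
  have hadd := integral_add (integrable_pow_mul_pow (μ := μ) hX hY hs ht)
    ((hXi.const_mul (1 - s)).add (hYi.const_mul (1 - t)))
  simp only [Pi.add_apply] at hadd
  rw [hadd, hlin] at hmono
  simp only [integral_const, probReal_univ, smul_eq_mul, mul_one] at hmono
  linarith

/-- The generating function at `(0, 0)` is the probability of extinction. -/
lemma integral_zero_pow_mul_zero_pow (hX : Measurable X) (hY : Measurable Y) :
    ∫ ω, (0 : ℝ) ^ X ω * 0 ^ Y ω ∂μ = 1 - (μ {ω | X ω ≠ 0 ∨ Y ω ≠ 0}).toReal := by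
  have hm : MeasurableSet {ω | X ω ≠ 0 ∨ Y ω ≠ 0} :=
    (hX (measurableSet_singleton 0)).compl.union (hY (measurableSet_singleton 0)).compl
  have hc := probReal_compl_eq_one_sub (μ := μ) hm
  rw [← measureReal_def, ← hc, ← integral_indicator_one hm.compl]
  refine integral_congr_ae (.of_forall fun ω => ?_)
  by_cases h1 : X ω = 0 <;> by_cases h2 : Y ω = 0 <;> simp [h1, h2]

end GeneratingFunctions

attribute [instance] GWSetup.mΩ GWSetup.hprob1 GWSetup.hprob2

namespace GWSetup

variable (S : GWSetup) {s t : ℝ}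

lemma F21_mem (n : ℕ) (hs : s ∈ Set.Icc (0 : ℝ) 1) (ht : t ∈ Set.Icc (0 : ℝ) 1) :
    S.F21 n s t ∈ Set.Icc (0 : ℝ) 1 :=
  integral_pow_mul_pow_mem_Icc (S.mZ1 n) (S.mZ2 n) hs ht

lemma F21_mono (n : ℕ) {s' t' : ℝ} (hs : 0 ≤ s) (hss : s ≤ s') (hs' : s' ≤ 1) (ht : 0 ≤ t)
    (htt : t ≤ t') (ht' : t' ≤ 1) : S.F21 n s t ≤ S.F21 n s' t' :=
  integral_pow_mul_pow_mono (S.mZ1 n) (S.mZ2 n) hs hss hs' ht htt ht'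

lemma F1_eq (n : ℕ) (s : ℝ) : S.F1 n s = ∫ ω, s ^ S.Z1 n ω * 1 ^ S.Z1 n ω ∂S.P1 := by
  simp [F1]

lemma F1_mem (n : ℕ) (hs : s ∈ Set.Icc (0 : ℝ) 1) : S.F1 n s ∈ Set.Icc (0 : ℝ) 1 := by
  rw [F1_eq]
  exact integral_pow_mul_pow_mem_Icc (S.mZ1 n) (S.mZ1 n) hs (by simp)

lemma F1_one (n : ℕ) : S.F1 n 1 = 1 := by simp [F1]

lemma F1_add (m n : ℕ) (hs : s ∈ Set.Icc (0 : ℝ) 1) :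
    S.F1 (m + n) s = S.F1 m (S.F1 n s) :=
  S.hbranch1 m n s hs.1 hs.2

lemma F21_add (m n : ℕ) (hs : s ∈ Set.Icc (0 : ℝ) 1) (ht : t ∈ Set.Icc (0 : ℝ) 1) :
    S.F21 (m + n) s t = S.F21 m (S.F1 n s) (S.F21 n s t) :=
  S.hbranch2 m n s t hs.1 hs.2 ht.1 ht.2

lemma F1_zero (s : ℝ) : S.F1 0 s = s := by
  have : S.F1 0 s = ∫ _, s ∂S.P1 := integral_congr_ae <| by
    filter_upwards [S.hinit1] with ω hω
    simp [hω.1]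
  simpa using this

lemma F21_zero (s t : ℝ) : S.F21 0 s t = t := by
  have : S.F21 0 s t = ∫ _, t ∂S.P2 := integral_congr_ae <| by
    filter_upwards [S.hinit2] with ω hω
    simp [hω.1, hω.2]
  simpa using this

lemma one_sub_F1_le (n : ℕ) (hs : s ∈ Set.Icc (0 : ℝ) 1) : 1 - S.F1 n s ≤ 1 - s := by
  induction n with
  | zero => rw [F1_zero]
  | succ n ih =>
    have hi : Integrable (fun ω => (S.Z1 1 ω : ℝ)) S.P1 :=
      .of_integral_ne_zero (by rw [S.hcrit1]; exact one_ne_zero)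
    have := one_sub_integral_pow_mul_pow_le_mean (S.mZ1 1) (S.mZ1 1) hi hi
      (S.F1_mem n hs) (t := 1) (by simp)
    rw [← F1_eq, S.hcrit1] at this
    rw [add_comm n 1, S.F1_add 1 n hs]
    linarith

lemma one_sub_F21_one_le (hs : s ∈ Set.Icc (0 : ℝ) 1) (ht : t ∈ Set.Icc (0 : ℝ) 1) :
    1 - S.F21 1 s t ≤ S.A21 * (1 - s) + (1 - t) := by
  have := one_sub_integral_pow_mul_pow_le_mean (S.mZ1 1) (S.mZ2 1)
    (.of_integral_ne_zero (by rw [S.hmean21]; exact S.hA21.ne'))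
    (.of_integral_ne_zero (by rw [S.hcrit2]; exact one_ne_zero)) hs ht (μ := S.P2)
  rw [S.hmean21, S.hcrit2] at this
  unfold F21
  linarith

/-- The mean number of type-1 particles at time `n` is at most `n * A21`. -/
lemma one_sub_F21_le_left (n : ℕ) (hs : s ∈ Set.Icc (0 : ℝ) 1) :
    1 - S.F21 n s 1 ≤ n * S.A21 * (1 - s) := by
  have hone : (1 : ℝ) ∈ Set.Icc (0 : ℝ) 1 := by simp
  induction n with
  | zero => simp [F21_zero]
  | succ n ih =>
    have h1 := S.one_sub_F21_one_le (S.F1_mem n hs) (S.F21_mem n hs hone)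
    have h2 := mul_le_mul_of_nonneg_left (S.one_sub_F1_le n hs) S.hA21.le
    rw [add_comm n 1, S.F21_add 1 n hs hone]
    push_cast
    linarith

lemma one_sub_F21_le (n : ℕ) (hs : s ∈ Set.Icc (0 : ℝ) 1) (ht : t ∈ Set.Icc (0 : ℝ) 1) :
    1 - S.F21 n s t ≤ n * S.A21 * (1 - s) + (1 - S.F21 n 1 t) :=
  (one_sub_integral_pow_mul_pow_le (S.mZ1 n) (S.mZ2 n) hs ht).trans
    (add_le_add_left (S.one_sub_F21_le_left n hs) _)

/-- The relative loss `(E[(1 - x)^Z₂(1)] - (1 - x)) / x` of one type-2 generation. -/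
noncomputable def lossRate (x : ℝ) : ℝ := (S.F21 1 1 (1 - x) - (1 - x)) / x

lemma one_sub_F21_one_one {x : ℝ} (hx : 0 < x) :
    1 - S.F21 1 1 (1 - x) = x * (1 - S.lossRate x) := by
  unfold lossRate
  field_simp
  ring

lemma lossRate_nonneg {x : ℝ} (hx : 0 < x) (hx1 : x ≤ 1) : 0 ≤ S.lossRate x := by
  have := S.one_sub_F21_one_le (s := 1) (t := 1 - x) (by simp) ⟨by linarith, by linarith⟩
  exact div_nonneg (by linarith) hx.le

lemma lossRate_mono {x y : ℝ} (hx : 0 < x) (hxy : x ≤ y) (hy : y ≤ 1) :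
    S.lossRate x ≤ S.lossRate y := by
  have hy0 : 0 < y := hx.trans_le hxy
  have hone : (1 : ℝ) ∈ Set.Icc (0 : ℝ) 1 := by simp
  have hxm : 1 - x ∈ Set.Icc (0 : ℝ) 1 := ⟨by linarith, by linarith⟩
  have hym : 1 - y ∈ Set.Icc (0 : ℝ) 1 := ⟨by linarith, by linarith⟩
  have hix := integrable_pow_mul_pow (μ := S.P2) (S.mZ1 1) (S.mZ2 1) hone hxm
  have hiy := integrable_pow_mul_pow (μ := S.P2) (S.mZ1 1) (S.mZ2 1) hone hym
  have hconv : S.F21 1 1 (1 - x) ≤ x / y * S.F21 1 1 (1 - y) + (1 - x / y) := by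
    have hmono := integral_mono hix
      ((hiy.const_mul (x / y)).add (integrable_const (1 - x / y))) fun ω => by
        have := (convexOn_pow (𝕜 := ℝ) (S.Z2 1 ω)).2 (x := 1 - y) (y := 1)
          (by simpa using hy) (by simp) (div_pos hx hy0).le
          (sub_nonneg.2 ((div_le_one hy0).2 hxy)) (add_sub_cancel _ _)
        have hcomb : x / y * (1 - y) + (1 - x / y) = 1 - x := by field_simp; ring
        simp only [smul_eq_mul, one_pow, mul_one, hcomb] at this
        simpa using this
    have hadd := integral_add (hiy.const_mul (x / y)) (integrable_const (1 - x / y))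
    rw [integral_const_mul] at hadd
    simp only [integral_const, probReal_univ, smul_eq_mul, one_mul] at hadd
    exact hmono.trans_eq hadd
  unfold lossRate
  rw [div_le_iff₀ hx]
  calc S.F21 1 1 (1 - x) - (1 - x)
      ≤ x / y * S.F21 1 1 (1 - y) + (1 - x / y) - (1 - x) := by linarith
    _ = (S.F21 1 1 (1 - y) - (1 - y)) / y * x := by field_simp; ring

lemma lossRate_eq {x : ℝ} (hx : 0 < x) (hx1 : x ≤ 1) :
    S.lossRate x = x ^ S.α2 * S.L2 x := by
  have := S.hF2 1 (1 - x) zero_le_one le_rfl (by linarith) (by linarith)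
  rw [sub_self, mul_zero, sub_zero, sub_sub_cancel, Real.rpow_add hx, Real.rpow_one] at this
  unfold lossRate F21
  rw [this]
  field_simp
  ring

lemma lossRate_regular (c : ℝ) (hc : 0 < c) :
    Tendsto (fun x => S.lossRate (c * x) / S.lossRate x) (𝓝[>] 0) (𝓝 (c ^ S.α2)) := by
  have h := (S.hL2 c hc).const_mul (c ^ S.α2)
  rw [mul_one] at h
  refine h.congr' ?_
  have hmem : Set.Ioo (0 : ℝ) (min 1 (1 / c)) ∈ 𝓝[>] (0 : ℝ) :=
    Ioo_mem_nhdsGT (by positivity)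
  filter_upwards [hmem] with x hx
  have hx1 : x ≤ 1 := hx.2.le.trans (min_le_left _ _)
  have hcx : c * x ≤ 1 := by
    have := hx.2.le.trans (min_le_right _ _)
    rwa [le_div_iff₀ hc, mul_comm] at this
  rw [S.lossRate_eq (mul_pos hc hx.1) hcx, S.lossRate_eq hx.1 hx1,
    Real.mul_rpow hc.le hx.1.le]
  have : x ^ S.α2 ≠ 0 := (Real.rpow_pos_of_pos hx.1 _).ne'
  by_cases hL : S.L2 x = 0
  · simp [hL]
  · field_simp

lemma lossRate_pos {x : ℝ} (hx : 0 < x) (hx1 : x ≤ 1) : 0 < S.lossRate x := by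
  have hlt : (0 : ℝ) < (1 : ℝ) ^ S.α2 := by simp
  obtain ⟨y, hy, hyx⟩ := (((S.lossRate_regular 1 one_pos).eventually_const_lt hlt).and
    (Ioo_mem_nhdsGT hx)).exists
  have hne : S.lossRate y ≠ 0 := fun h0 => by simp [h0] at hy
  exact ((S.lossRate_nonneg hyx.1 (hyx.2.le.trans hx1)).lt_of_ne' hne).trans_le
    (S.lossRate_mono hyx.1 hyx.2.le hx1)

lemma one_sub_F21_right_le (n : ℕ) (ht : t ∈ Set.Icc (0 : ℝ) 1) :
    1 - S.F21 n 1 t ≤ 1 - t := by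
  have hone : (1 : ℝ) ∈ Set.Icc (0 : ℝ) 1 := by simp
  induction n with
  | zero => rw [F21_zero]
  | succ n ih =>
    have := S.one_sub_F21_one_le hone (S.F21_mem n hone ht)
    rw [add_comm n 1, S.F21_add 1 n hone ht, F1_one]
    linarith

/-- Over `n` generations the type-2 process loses a fraction at most `n * lossRate`. -/
lemma le_one_sub_F21_right (n : ℕ) {x y : ℝ} (hx : 0 < x) (hxy : x ≤ y) (hy : y ≤ 1) :
    x * (1 - n * S.lossRate y) ≤ 1 - S.F21 n 1 (1 - x) := by
  have hone : (1 : ℝ) ∈ Set.Icc (0 : ℝ) 1 := by simp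
  have ht : 1 - x ∈ Set.Icc (0 : ℝ) 1 := ⟨by linarith, by linarith⟩
  have hl := S.lossRate_nonneg (hx.trans_le hxy) hy
  induction n with
  | zero => simp [F21_zero]
  | succ n ih =>
    have hle := S.one_sub_F21_right_le n ht
    have hmem := S.F21_mem n hone ht
    rw [add_comm n 1, S.F21_add 1 n hone ht, F1_one]
    obtain ⟨z, hz⟩ : ∃ z, z = 1 - S.F21 n 1 (1 - x) := ⟨_, rfl⟩
    rw [← hz] at ih hle
    rw [show S.F21 n 1 (1 - x) = 1 - z by rw [hz]; ring]
    have hz0 : 0 ≤ z := by rw [hz]; linarith [hmem.2]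
    push_cast
    rcases hz0.eq_or_lt with h0 | hzpos
    · subst h0
      have h1 : (S.F21 1 1 (1 - 0)) ≤ 1 := (S.F21_mem 1 hone (by simp)).2
      nlinarith [mul_nonneg hx.le hl]
    · rw [S.one_sub_F21_one_one hzpos]
      have := S.lossRate_mono hzpos (show z ≤ y by linarith) hy
      have hzx : z ≤ x := by linarith
      have := mul_le_mul_of_nonneg_left this hz0
      nlinarith [mul_le_mul_of_nonneg_right hzx hl]

lemma Q1_eq (n : ℕ) : S.Q1 n = 1 - S.F1 n 0 := by
  have := integral_zero_pow_mul_zero_pow (μ := S.P1) (S.mZ1 n) (S.mZ1 n)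
  have h2 : S.F1 n 0 = ∫ ω, (0 : ℝ) ^ S.Z1 n ω * 0 ^ S.Z1 n ω ∂S.P1 :=
    integral_congr_ae (.of_forall fun ω => by by_cases h : S.Z1 n ω = 0 <;> simp [h])
  rw [h2, this]
  simp [Q1]

lemma Q2_eq (n : ℕ) : S.Q2 n = 1 - S.F21 n 1 0 := by
  have := integral_zero_pow_mul_zero_pow (μ := S.P2) (S.mZ2 n) (S.mZ2 n)
  have h2 : S.F21 n 1 0 = ∫ ω, (0 : ℝ) ^ S.Z2 n ω * 0 ^ S.Z2 n ω ∂S.P2 :=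
    integral_congr_ae (.of_forall fun ω => by by_cases h : S.Z2 n ω = 0 <;> simp [h])
  rw [h2, this]
  simp [Q2]

lemma Q21_eq (n : ℕ) : S.Q21 n = 1 - S.F21 n 0 0 := by
  have := integral_zero_pow_mul_zero_pow (μ := S.P2) (S.mZ1 n) (S.mZ2 n)
  unfold F21
  rw [this]
  simp [Q21, surv]

lemma Q1_mem (n : ℕ) : S.Q1 n ∈ Set.Icc (0 : ℝ) 1 := by
  have := S.F1_mem n (s := 0) (by simp)
  rw [Q1_eq]
  exact ⟨by linarith [this.2], by linarith [this.1]⟩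

lemma Q2_mem (n : ℕ) : S.Q2 n ∈ Set.Icc (0 : ℝ) 1 := by
  have := S.F21_mem n (s := 1) (t := 0) (by simp) (by simp)
  rw [Q2_eq]
  exact ⟨by linarith [this.2], by linarith [this.1]⟩

lemma Q21_mem (n : ℕ) : S.Q21 n ∈ Set.Icc (0 : ℝ) 1 := by
  have := S.F21_mem n (s := 0) (t := 0) (by simp) (by simp)
  rw [Q21_eq]
  exact ⟨by linarith [this.2], by linarith [this.1]⟩

lemma Q2_le_Q21 (n : ℕ) : S.Q2 n ≤ S.Q21 n := by
  rw [Q2_eq, Q21_eq]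
  have := S.F21_mono n (s := 0) (s' := 1) (t := 0) (t' := 0) le_rfl zero_le_one le_rfl le_rfl
    le_rfl zero_le_one
  linarith

lemma Q21_add (m n : ℕ) : S.Q21 (m + n) = 1 - S.F21 m (1 - S.Q1 n) (1 - S.Q21 n) := by
  rw [Q21_eq, S.F21_add m n (by simp) (by simp), Q1_eq, Q21_eq]
  simp

lemma Q21_antitone : Antitone S.Q21 := by
  intro a b hab
  obtain ⟨k, rfl⟩ := Nat.exists_eq_add_of_le hab
  rw [Q21_add, S.Q21_eq a]
  have h1 := S.Q1_mem k
  have h2 := S.Q21_mem k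
  have := S.F21_mono a (s := 0) (s' := 1 - S.Q1 k) (t := 0) (t' := 1 - S.Q21 k) le_rfl
    (by linarith [h1.2]) (by linarith [h1.1]) le_rfl (by linarith [h2.2]) (by linarith [h2.1])
  linarith

lemma Q2_succ (n : ℕ) (hn : 0 < S.Q2 n) :
    S.Q2 (n + 1) = S.Q2 n * (1 - S.lossRate (S.Q2 n)) := by
  rw [← S.one_sub_F21_one_one hn, S.Q2_eq (n + 1), add_comm n 1,
    S.F21_add 1 n (by simp) (by simp), F1_one, S.Q2_eq n, sub_sub_cancel]

lemma Q2_antitone : Antitone S.Q2 := antitone_nat_of_succ_le fun n => by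
  rcases (S.Q2_mem n).1.eq_or_lt with h0 | hpos
  · have := S.one_sub_F21_one_le (s := 1) (t := 1) (by simp) (by simp)
    rw [S.Q2_eq (n + 1), add_comm n 1, S.F21_add 1 n (by simp) (by simp), F1_one,
      show S.F21 n 1 0 = 1 by linarith [S.Q2_eq n]]
    linarith
  · rw [S.Q2_succ n hpos]
    nlinarith [S.lossRate_nonneg hpos (S.Q2_mem n).2]

lemma Q21_add_self_le (n : ℕ) : S.Q21 (n + n) ≤ n * S.A21 * S.Q1 n + S.Q2 n := by
  have h1 := S.Q1_mem n
  have h2 := S.Q21_mem n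
  have hs : 1 - S.Q1 n ∈ Set.Icc (0 : ℝ) 1 := ⟨by linarith [h1.2], by linarith [h1.1]⟩
  have ht : 1 - S.Q21 n ∈ Set.Icc (0 : ℝ) 1 := ⟨by linarith [h2.2], by linarith [h2.1]⟩
  have h3 := S.one_sub_F21_le n hs ht
  have h4 := S.F21_mono n (s := 1) zero_le_one le_rfl le_rfl le_rfl ht.1 ht.2
  rw [Q21_add, S.Q2_eq]
  linarith

lemma CondC.Q2_pos {S : GWSetup} {σ : ℝ} (hC : S.CondC σ) (n : ℕ) : 0 < S.Q2 n := by
  obtain ⟨k, hk, hnk⟩ := ((hC.eventually_const_lt one_pos).and (eventually_ge_atTop n)).exists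
  refine ((S.Q2_mem k).1.lt_of_ne' fun h0 => ?_).trans_le (S.Q2_antitone hnk)
  simp [h0] at hk

lemma CondC.eventually_le {S : GWSetup} {σ : ℝ} (hσ : 0 < σ) (hC : S.CondC σ) :
    ∀ᶠ n : ℕ in atTop, n * S.Q1 n ≤ 2 * σ * S.Q2 n := by
  filter_upwards [hC.eventually_lt_const one_lt_two] with n hn
  rw [div_lt_iff₀ (mul_pos hσ (hC.Q2_pos n))] at hn
  linarith

/-- Under condition (C) the loss rate at the survival probability is `O(1/n)`. -/
lemma CondC.lossRate_Q21_bounded {S : GWSetup} {σ : ℝ} (hσ : 0 < σ) (hC : S.CondC σ) :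
    ∃ V : ℝ, 0 ≤ V ∧ ∀ᶠ n : ℕ in atTop, n * S.lossRate (S.Q21 n) ≤ V := by
  obtain ⟨hlim, U, hU⟩ := tendsto_zero_and_bounded_of_decrement (q := S.Q2) (h := S.lossRate)
    S.hα2.1 hC.Q2_pos (fun n => (S.Q2_mem n).2) (fun n => S.Q2_succ n (hC.Q2_pos n))
    (fun _ _ => S.lossRate_mono) (fun _ => S.lossRate_pos) S.lossRate_regular
  have hU0 : 0 ≤ U := by simpa using hU 0
  set C : ℝ := 1 + 2 * σ * S.A21 with hCdef
  have hC0 : 0 < C := by have := S.hA21; positivity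
  set M : ℝ := C ^ S.α2 + 1
  have hM : 0 ≤ M := by positivity
  have hlim' : Tendsto S.Q2 atTop (𝓝[>] 0) :=
    tendsto_nhdsWithin_iff.2 ⟨hlim, .of_forall hC.Q2_pos⟩
  have hev : ∀ᶠ j : ℕ in atTop, S.lossRate (C * S.Q2 j) / S.lossRate (S.Q2 j) < M ∧
      S.Q2 j < 1 / C ∧ j * S.Q1 j ≤ 2 * σ * S.Q2 j :=
    (hlim'.eventually ((S.lossRate_regular C hC0).eventually_lt_const (lt_add_one _))).and
      ((hlim.eventually_lt_const (by positivity)).and (hC.eventually_le hσ))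
  obtain ⟨N, hN⟩ := eventually_atTop.1 hev
  refine ⟨3 * M * U, by positivity, eventually_atTop.2 ⟨2 * (N + 1), fun n hn => ?_⟩⟩
  obtain ⟨j, hj⟩ : ∃ j, j = n / 2 := ⟨_, rfl⟩
  obtain ⟨h1, h2, h3⟩ := hN j (by omega)
  have hq := hC.Q2_pos j
  have hl := S.lossRate_pos hq (S.Q2_mem j).2
  rw [div_lt_iff₀ hl] at h1
  rw [lt_div_iff₀ hC0, mul_comm] at h2
  have hle : S.Q21 n ≤ C * S.Q2 j := by
    have h4 := S.Q21_antitone (show j + j ≤ n by omega)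
    have h5 := S.Q21_add_self_le j
    have h6 := mul_le_mul_of_nonneg_left h3 S.hA21.le
    rw [hCdef]
    nlinarith
  have h7 := S.lossRate_mono ((hC.Q2_pos n).trans_le (S.Q2_le_Q21 n)) hle h2.le
  have hnj : (n : ℝ) ≤ 3 * j := by exact_mod_cast (by omega : n ≤ 3 * j)
  calc n * S.lossRate (S.Q21 n) ≤ 3 * j * (M * S.lossRate (S.Q2 j)) :=
        mul_le_mul hnj (h7.trans h1.le)
          (S.lossRate_nonneg ((hC.Q2_pos n).trans_le (S.Q2_le_Q21 n)) (S.Q21_mem n).2)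
          (by positivity)
    _ = 3 * M * (j * S.lossRate (S.Q2 j)) := by ring
    _ ≤ 3 * M * U := mul_le_mul_of_nonneg_left (hU j) (by positivity)

lemma measurableSet_surv (n : ℕ) : MeasurableSet (S.surv n) :=
  (S.mZ1 n (measurableSet_singleton 0)).compl.union (S.mZ2 n (measurableSet_singleton 0)).compl

/-- The generating function of the reduced process in terms of that of `Z(m)`. -/
lemma Ered_pow_eq {m n : ℕ} (hmn : m ≤ n) (hs : s ∈ Set.Icc (0 : ℝ) 1)
    (ht : t ∈ Set.Icc (0 : ℝ) 1) (hQ : 0 < S.Q21 n) :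
    S.Ered m n (fun k l => s ^ k * t ^ l) =
      1 - (1 - S.F21 m (1 - (1 - s) * S.Q1 (n - m)) (1 - (1 - t) * S.Q21 (n - m))) /
        S.Q21 n := by
  have hred := S.hreduced m n hmn s t hs.1 hs.2 ht.1 ht.2
  have hi := integrable_pow_mul_pow (μ := S.P2) (S.mR1 m n) (S.mR2 m n) hs ht
  have hsplit := integral_add_compl (S.measurableSet_surv n) hi
  have hcompl : ∫ ω in (S.surv n)ᶜ, s ^ S.R1 m n ω * t ^ S.R2 m n ω ∂S.P2 =
      1 - S.Q21 n := by
    have : ∫ ω in (S.surv n)ᶜ, s ^ S.R1 m n ω * t ^ S.R2 m n ω ∂S.P2 =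
        ∫ _ in (S.surv n)ᶜ, (1 : ℝ) ∂S.P2 := by
      refine setIntegral_congr_ae (S.measurableSet_surv n).compl ?_
      filter_upwards [S.hext m n] with ω hω hmem
      have hz : S.Z1 n ω = 0 ∧ S.Z2 n ω = 0 := by
        simpa [surv] using hmem
      simp [hω hz]
    rw [this, setIntegral_const, probReal_compl_eq_one_sub (S.measurableSet_surv n)]
    simp [Q21, measureReal_def]
  change _ = S.F21 m (1 - (1 - s) * S.Q1 (n - m)) (1 - (1 - t) * S.Q21 (n - m)) at hred
  have hval : ∫ ω in S.surv n, s ^ S.R1 m n ω * t ^ S.R2 m n ω ∂S.P2 =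
      S.F21 m (1 - (1 - s) * S.Q1 (n - m)) (1 - (1 - t) * S.Q21 (n - m)) -
        (1 - S.Q21 n) := by linarith
  unfold Ered
  rw [hval]
  field_simp
  ring

end GWSetup

/-- Theorem `T_VatSag`(0).  Under Condition (C)
(`n Q₁(n) ~ σ Q₂(n)`), for any `s₁, s₂ ∈ (0,1)` and any integer sequence
`m(n)` with `1 ≤ m(n) ≪ n`,
`E[s₁^{Z₁(m,n)} s₂^{Z₂(m,n)} | Z(n) ≠ 0, Z(0) = e₂] → s₂`. -/
theorem condC_early_reduced_pgf (S : GWSetup)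
    (σ : ℝ) (hσ : 0 < σ) (hC : S.CondC σ)
    (s1 s2 : ℝ) (hs1 : s1 ∈ Set.Ioo (0 : ℝ) 1) (hs2 : s2 ∈ Set.Ioo (0 : ℝ) 1)
    (m : ℕ → ℕ) (hm1 : ∀ n, 1 ≤ m n)
    (hmn : Filter.Tendsto (fun n : ℕ => (m n : ℝ) / (n : ℝ)) Filter.atTop (nhds 0)) :
    Filter.Tendsto (fun n : ℕ => S.Ered (m n) n (fun k l => s1 ^ k * s2 ^ l))
      Filter.atTop (nhds s2) := by
  have hA := S.hA21
  obtain ⟨V, hV0, hV⟩ := hC.lossRate_Q21_bounded hσ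
  obtain ⟨N, hN⟩ := eventually_atTop.1 (hV.and (hC.eventually_le hσ))
  have hs1' : s1 ∈ Set.Icc (0 : ℝ) 1 := ⟨hs1.1.le, hs1.2.le⟩
  have hs2' : s2 ∈ Set.Icc (0 : ℝ) 1 := ⟨hs2.1.le, hs2.2.le⟩
  have hQ : ∀ k, 0 < S.Q21 k := fun k => (hC.Q2_pos k).trans_le (S.Q2_le_Q21 k)
  have hlow : Tendsto (fun n : ℕ => 1 - (1 - s2 + 4 * σ * S.A21 * ((m n : ℝ) / n)) /
      (1 - 2 * V * ((m n : ℝ) / n))) atTop (𝓝 s2) := by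
    have h := ((hmn.const_mul (4 * σ * S.A21)).const_add (1 - s2)).div
      ((hmn.const_mul (2 * V)).const_sub 1) (by simp)
    simpa using h.const_sub 1
  have hupp : Tendsto (fun n : ℕ => 1 - (1 - s2) * (1 - 2 * V * ((m n : ℝ) / n)))
      atTop (𝓝 s2) := by
    simpa using (((hmn.const_mul (2 * V)).const_sub 1).const_mul (1 - s2)).const_sub 1
  have hsmall : ∀ᶠ n : ℕ in atTop, 2 * V * ((m n : ℝ) / n) < 1 :=
    (hmn.const_mul (2 * V)).eventually_lt_const (by simp)
  have hbounds : ∀ᶠ n : ℕ in atTop,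
      (1 - (1 - s2 + 4 * σ * S.A21 * ((m n : ℝ) / n)) / (1 - 2 * V * ((m n : ℝ) / n)) ≤
        S.Ered (m n) n (fun k l => s1 ^ k * s2 ^ l)) ∧
      S.Ered (m n) n (fun k l => s1 ^ k * s2 ^ l) ≤
        1 - (1 - s2) * (1 - 2 * V * ((m n : ℝ) / n)) := by
    filter_upwards [hsmall, hmn.eventually_lt_const (by norm_num : (0 : ℝ) < 1 / 2),
      eventually_ge_atTop (2 * N + 1)] with n hr1 hr2 hn
    have hn0 : (0 : ℝ) < n := by exact_mod_cast (by omega : 0 < n)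
    have h2m : 2 * m n ≤ n := by
      rw [div_lt_iff₀ hn0] at hr2
      exact_mod_cast (by linarith : (2 : ℝ) * m n ≤ n)
    set r : ℝ := (m n : ℝ) / n with hr
    have hmr : (m n : ℝ) = r * n := by rw [hr]; field_simp
    have hr0 : 0 ≤ r := by positivity
    obtain ⟨k, hk⟩ : ∃ k, k = n - m n := ⟨_, rfl⟩
    have hnk : n = m n + k := by omega
    have hn2k : (n : ℝ) ≤ 2 * k := by exact_mod_cast (by omega : n ≤ 2 * k)
    obtain ⟨hVk, hQk⟩ := hN k (by omega)
    rw [S.Ered_pow_eq (by omega) hs1' hs2' (hQ n), ← hk]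
    have hD := hQ k
    have hD1 := (S.Q21_mem k).2
    have hD' := hQ n
    have hDD : S.Q21 n ≤ S.Q21 k := S.Q21_antitone (by omega)
    have hloss : m n * S.lossRate (S.Q21 k) ≤ 2 * V * r := by
      have h0 := S.lossRate_nonneg hD hD1
      calc m n * S.lossRate (S.Q21 k) = r * (n * S.lossRate (S.Q21 k)) := by rw [hmr]; ring
        _ ≤ r * (2 * V) := mul_le_mul_of_nonneg_left (by nlinarith) hr0
        _ = 2 * V * r := by ring
    have hratio : S.Q21 k * (1 - 2 * V * r) ≤ S.Q21 n := by
      have h1 := S.le_one_sub_F21_right (m n) hD le_rfl hD1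
      have hq1 := S.Q1_mem k
      have h2 := S.F21_mono (m n) (s := 1 - S.Q1 k) (s' := 1) (t := 1 - S.Q21 k)
        (by linarith [hq1.2]) (by linarith [hq1.1]) le_rfl (by linarith) le_rfl (by linarith)
      have h3 := S.Q21_add (m n) k
      rw [← hnk] at h3
      have := mul_le_mul_of_nonneg_left hloss hD.le
      linarith
    have hq1 := S.Q1_mem k
    set a : ℝ := (1 - s1) * S.Q1 k
    set b : ℝ := (1 - s2) * S.Q21 k
    have ha0 : 0 ≤ a := mul_nonneg (by linarith [hs1.2]) hq1.1
    have haq : a ≤ S.Q1 k := mul_le_of_le_one_left hq1.1 (by linarith [hs1.1])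
    have hb0 : 0 < b := mul_pos (by linarith [hs2.2]) hD
    have hbD : b ≤ S.Q21 k := mul_le_of_le_one_left hD.le (by linarith [hs2.1])
    have hma : 1 - a ∈ Set.Icc (0 : ℝ) 1 := ⟨by linarith [hq1.2], by linarith⟩
    have hmb : 1 - b ∈ Set.Icc (0 : ℝ) 1 := ⟨by linarith, by linarith⟩
    have hs2p : 0 < 1 - s2 := by linarith [hs2.2]
    have hrp : 0 < 1 - 2 * V * r := by linarith
    refine ⟨sub_le_sub_left ?_ 1, sub_le_sub_left ?_ 1⟩
    · rw [div_le_div_iff₀ hD' hrp]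
      have h1 := S.one_sub_F21_le (m n) hma hmb
      have h2 := S.one_sub_F21_right_le (m n) hmb
      have h3 : m n * a ≤ 4 * σ * r * S.Q21 k := by
        have hQ2 := S.Q2_le_Q21 k
        calc m n * a ≤ m n * S.Q1 k := mul_le_mul_of_nonneg_left haq (Nat.cast_nonneg _)
          _ = r * (n * S.Q1 k) := by rw [hmr]; ring
          _ ≤ r * (4 * σ * S.Q21 k) := mul_le_mul_of_nonneg_left
            (by nlinarith [mul_le_mul_of_nonneg_right hn2k hq1.1]) hr0
          _ = _ := by ring
      have h4 : 1 - S.F21 (m n) (1 - a) (1 - b) ≤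
          (1 - s2 + 4 * σ * S.A21 * r) * S.Q21 k := by
        have := mul_le_mul_of_nonneg_left h3 hA.le
        calc _ ≤ S.A21 * (m n * a) + b := by linarith
          _ ≤ S.A21 * (4 * σ * r * S.Q21 k) + (1 - s2) * S.Q21 k := by gcongr
          _ = _ := by ring
      calc _ ≤ (1 - s2 + 4 * σ * S.A21 * r) * S.Q21 k * (1 - 2 * V * r) :=
            mul_le_mul_of_nonneg_right h4 hrp.le
        _ = (1 - s2 + 4 * σ * S.A21 * r) * (S.Q21 k * (1 - 2 * V * r)) := by ring
        _ ≤ _ := mul_le_mul_of_nonneg_left hratio (by positivity)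
    · rw [le_div_iff₀ hD']
      have h1 := S.le_one_sub_F21_right (m n) hb0 hbD hD1
      have h2 := S.F21_mono (m n) hma.1 hma.2 le_rfl hmb.1 le_rfl hmb.2
      calc (1 - s2) * (1 - 2 * V * r) * S.Q21 n
          ≤ (1 - s2) * (1 - 2 * V * r) * S.Q21 k :=
            mul_le_mul_of_nonneg_left hDD (by positivity)
        _ = b * (1 - 2 * V * r) := by ring
        _ ≤ b * (1 - m n * S.lossRate (S.Q21 k)) :=
            mul_le_mul_of_nonneg_left (by linarith) hb0.le
        _ ≤ _ := by linarith
  exact tendsto_of_tendsto_of_tendsto_of_le_of_le' hlow hupp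
    (hbounds.mono fun _ h => h.1) (hbounds.mono fun _ h => h.2)
end

section
/- Let i ∈ {1,2} and let m = m(n) be a sequence of nonnegative integers with m(n)/n → 0. Then for every λ > 0, as n → ∞, Q_i(m(n); e^{-λQ_i(n)}) ~ λQ_i(n) ~ Q_i(m(n); 1 - λQ_i(n)). -/
open MeasureTheory Filter Topology

/-- One step `x ↦ x (1 - ψ x)` of the recursion satisfied by the survival probabilities. -/
noncomputable def decayStep (ψ : ℝ → ℝ) (x : ℝ) : ℝ := x * (1 - ψ x)

section Recursion

open Set

variable {ψ : ℝ → ℝ}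

lemma decayStep_mem (h0 : ∀ x ∈ Ioc (0 : ℝ) 1, 0 ≤ ψ x) (h1 : ∀ x ∈ Ioc (0 : ℝ) 1, ψ x < 1)
    {x : ℝ} (hx : x ∈ Ioc (0 : ℝ) 1) :
    decayStep ψ x ∈ Ioc (0 : ℝ) 1 ∧ decayStep ψ x ≤ x := by
  have a := h0 x hx
  have b := h1 x hx
  have hle : decayStep ψ x ≤ x := by
    unfold decayStep; nlinarith [hx.1]
  exact ⟨⟨mul_pos hx.1 (by linarith), hle.trans hx.2⟩, hle⟩

lemma decayStep_iterate_mem (h0 : ∀ x ∈ Ioc (0 : ℝ) 1, 0 ≤ ψ x)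
    (h1 : ∀ x ∈ Ioc (0 : ℝ) 1, ψ x < 1) {x : ℝ} (hx : x ∈ Ioc (0 : ℝ) 1) (k : ℕ) :
    (decayStep ψ)^[k] x ∈ Ioc (0 : ℝ) 1 ∧ (decayStep ψ)^[k] x ≤ x := by
  induction k with
  | zero => exact ⟨hx, le_rfl⟩
  | succ k ih =>
    rw [Function.iterate_succ_apply']
    have := decayStep_mem h0 h1 ih.1
    exact ⟨this.1, this.2.trans ih.2⟩

lemma le_decayStep_iterate (hmono : MonotoneOn ψ (Ioc 0 1))
    (h0 : ∀ x ∈ Ioc (0 : ℝ) 1, 0 ≤ ψ x) (h1 : ∀ x ∈ Ioc (0 : ℝ) 1, ψ x < 1)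
    {x : ℝ} (hx : x ∈ Ioc (0 : ℝ) 1) (k : ℕ) :
    x * (1 - k * ψ x) ≤ (decayStep ψ)^[k] x := by
  induction k with
  | zero => simp
  | succ k ih =>
    rw [Function.iterate_succ_apply']
    obtain ⟨hm, hle⟩ := decayStep_iterate_mem h0 h1 hx k
    have hψ := hmono hm hx hle
    have := h0 x hx
    unfold decayStep at *
    push_cast
    nlinarith [mul_le_mul_of_nonneg_left hψ hm.1.le, mul_le_mul_of_nonneg_right hle this]

lemma decayStep_iterate_le (hmono : MonotoneOn ψ (Ioc 0 1))
    (h0 : ∀ x ∈ Ioc (0 : ℝ) 1, 0 ≤ ψ x) (h1 : ∀ x ∈ Ioc (0 : ℝ) 1, ψ x < 1)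
    {x y : ℝ} (hx : x ∈ Ioc (0 : ℝ) 1) (hy : 0 < y) (k : ℕ)
    (hyk : y ≤ (decayStep ψ)^[k] x) :
    (decayStep ψ)^[k] x ≤ x * (1 - ψ y) ^ k := by
  induction k with
  | zero => simp
  | succ k ih =>
    rw [Function.iterate_succ_apply'] at hyk ⊢
    obtain ⟨hm, -⟩ := decayStep_iterate_mem h0 h1 hx k
    have hyk' := hyk.trans (decayStep_mem h0 h1 hm).2
    have hy1 : y ∈ Ioc (0 : ℝ) 1 := ⟨hy, hyk'.trans hm.2⟩
    have hψ := hmono hy1 hm hyk'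
    calc decayStep ψ ((decayStep ψ)^[k] x)
        ≤ (decayStep ψ)^[k] x * (1 - ψ y) :=
          mul_le_mul_of_nonneg_left (by linarith) hm.1.le
      _ ≤ x * (1 - ψ y) ^ k * (1 - ψ y) :=
          mul_le_mul_of_nonneg_right (ih hyk') (by linarith [h1 y hy1])
      _ = x * (1 - ψ y) ^ (k + 1) := by ring

lemma tendsto_decayStep_iterate (hmono : MonotoneOn ψ (Ioc 0 1))
    (h0 : ∀ x ∈ Ioc (0 : ℝ) 1, 0 < ψ x) (h1 : ∀ x ∈ Ioc (0 : ℝ) 1, ψ x < 1) :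
    Tendsto (fun n => (decayStep ψ)^[n] 1) atTop (𝓝[>] 0) := by
  have h0' : ∀ x ∈ Ioc (0 : ℝ) 1, 0 ≤ ψ x := fun x hx => (h0 x hx).le
  have one_mem : (1 : ℝ) ∈ Ioc (0 : ℝ) 1 := by simp
  have hpos := fun n => (decayStep_iterate_mem h0' h1 one_mem n).1
  refine tendsto_nhdsWithin_iff.2 ⟨?_, Eventually.of_forall fun n => (hpos n).1⟩
  refine tendsto_order.2 ⟨fun a ha => Eventually.of_forall fun n => ha.trans (hpos n).1,
    fun ε hε => ?_⟩
  set y := min ε 1 with hy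
  have hy1 : y ∈ Ioc (0 : ℝ) 1 := ⟨lt_min hε one_pos, min_le_right _ _⟩
  have hlim := tendsto_pow_atTop_nhds_zero_of_lt_one (r := 1 - ψ y)
    (by linarith [h1 y hy1]) (by linarith [h0 y hy1])
  filter_upwards [hlim.eventually (gt_mem_nhds hy1.1)] with n hn
  by_contra! hcon
  have := decayStep_iterate_le hmono h0' h1 one_mem hy1.1 n ((min_le_left _ _).trans hcon)
  linarith [min_le_left ε 1]

lemma exists_nat_mul_decayStep_iterate_le {α : ℝ} (hα : 0 < α) (hmono : MonotoneOn ψ (Ioc 0 1))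
    (h0 : ∀ x ∈ Ioc (0 : ℝ) 1, 0 < ψ x) (h1 : ∀ x ∈ Ioc (0 : ℝ) 1, ψ x < 1)
    (hreg : ∀ c : ℝ, 0 < c → Tendsto (fun x => ψ (c * x) / ψ x) (𝓝[>] 0) (𝓝 (c ^ α))) :
    ∃ C : ℝ, ∀ n : ℕ, n * ψ ((decayStep ψ)^[n] 1) ≤ C := by
  have h0' : ∀ x ∈ Ioc (0 : ℝ) 1, 0 ≤ ψ x := fun x hx => (h0 x hx).le
  have one_mem : (1 : ℝ) ∈ Ioc (0 : ℝ) 1 := by simp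
  have hmem := fun n => (decayStep_iterate_mem h0' h1 one_mem n).1
  set c : ℝ := 4 ^ α⁻¹ with hc
  have hc0 : 0 < c := by positivity
  have hcα : c ^ α = 4 := by
    rw [hc, ← Real.rpow_mul (by norm_num), inv_mul_cancel₀ hα.ne', Real.rpow_one]
  have hev := (tendsto_decayStep_iterate hmono h0 h1).eventually
    ((hreg c hc0).eventually (lt_mem_nhds (a := 3) (by rw [hcα]; norm_num)))
  obtain ⟨N, hN⟩ := eventually_atTop.1 hev
  set C : ℝ := max (2 * Real.log c) (2 * (N + 1)) with hC
  refine ⟨C, fun n => ?_⟩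
  induction n using Nat.strong_induction_on with
  | _ n ih =>
    set q := fun n => (decayStep ψ)^[n] 1 with hq
    change n * ψ (q n) ≤ C
    by_cases hn : n < 2 * (N + 1)
    · have hn' : (n : ℝ) ≤ 2 * (N + 1) := by exact_mod_cast hn.le
      refine le_trans ?_ (le_max_right _ _)
      nlinarith [h1 _ (hmem n), h0 _ (hmem n), Nat.cast_nonneg (α := ℝ) n]
    · by_contra! hcon
      push Not at hn
      have hlog : 2 * Real.log c < n * ψ (q n) := (le_max_left _ _).trans_lt hcon
      obtain ⟨k, l, hkl, hlk, hk3⟩ : ∃ k l, n = l + k ∧ n ≤ 2 * l ∧ n ≤ 3 * k :=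
        ⟨n / 2, n - n / 2, by omega, by omega, by omega⟩
      have hit : (decayStep ψ)^[l] (q k) = q n := by
        rw [hkl]; exact (Function.iterate_add_apply _ _ _ _).symm
      have hle := decayStep_iterate_le hmono h0' h1 (hmem k) (hmem n).1 l hit.ge
      rw [hit] at hle
      have hψ0 := h0 _ (hmem n)
      have hψ1 := h1 _ (hmem n)
      have hpow : (1 - ψ (q n)) ^ l ≤ c⁻¹ := by
        calc (1 - ψ (q n)) ^ l ≤ (Real.exp (-ψ (q n))) ^ l :=
              pow_le_pow_left₀ (by linarith) (by linarith [Real.add_one_le_exp (-ψ (q n))]) _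
          _ = Real.exp (l * -ψ (q n)) := (Real.exp_nat_mul _ _).symm
          _ ≤ Real.exp (-Real.log c) := by
              have : (n : ℝ) ≤ 2 * l := by exact_mod_cast hlk
              refine Real.exp_le_exp.2 ?_
              nlinarith
          _ = c⁻¹ := by rw [Real.exp_neg, Real.exp_log hc0]
      have hck : c * q n ≤ q k := by
        have : q n ≤ q k * c⁻¹ := hle.trans (mul_le_mul_of_nonneg_left hpow (hmem k).1.le)
        calc c * q n ≤ c * (q k * c⁻¹) := by gcongr
          _ = q k := by field_simp
      have hm := hmono ⟨mul_pos hc0 (hmem n).1, hck.trans (hmem k).2⟩ (hmem k) hck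
      have h3 := hN n (by omega)
      rw [lt_div_iff₀ hψ0] at h3
      have hk := ih k (by omega)
      have hk3' : (n : ℝ) ≤ 3 * k := by exact_mod_cast hk3
      have hk0 : (0 : ℝ) ≤ k := Nat.cast_nonneg k
      have : (k : ℝ) * (3 * ψ (q n)) ≤ k * ψ (q k) :=
        mul_le_mul_of_nonneg_left (h3.le.trans hm) hk0
      have hk' : (k : ℝ) * ψ (q k) ≤ C := hk
      nlinarith

/-- Starting from a point `x n` comparable with the `n`-th iterate, `m n = o(n)` steps of the
recursion do not change the order of magnitude. -/
lemma tendsto_decayStep_iterate_div {α : ℝ} (hα : 0 < α) (hmono : MonotoneOn ψ (Ioc 0 1))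
    (h0 : ∀ x ∈ Ioc (0 : ℝ) 1, 0 < ψ x) (h1 : ∀ x ∈ Ioc (0 : ℝ) 1, ψ x < 1)
    (hreg : ∀ c : ℝ, 0 < c → Tendsto (fun x => ψ (c * x) / ψ x) (𝓝[>] 0) (𝓝 (c ^ α)))
    {m : ℕ → ℕ} (hm : Tendsto (fun n : ℕ => (m n : ℝ) / n) atTop (𝓝 0))
    {lam : ℝ} (hlam : 0 < lam) {x : ℕ → ℝ} (hx0 : ∀ n, 0 < x n)
    (hx : ∀ n, x n ≤ lam * (decayStep ψ)^[n] 1) :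
    Tendsto (fun n => (decayStep ψ)^[m n] (x n) / x n) atTop (𝓝 1) := by
  have h0' : ∀ x ∈ Ioc (0 : ℝ) 1, 0 ≤ ψ x := fun x hx => (h0 x hx).le
  have one_mem : (1 : ℝ) ∈ Ioc (0 : ℝ) 1 := by simp
  have hmem := fun n => (decayStep_iterate_mem h0' h1 one_mem n).1
  have hlim := tendsto_decayStep_iterate hmono h0 h1
  obtain ⟨C, hC⟩ := exists_nat_mul_decayStep_iterate_le hα hmono h0 h1 hreg
  set K := lam ^ α + 1 with hK
  have hK0 : 0 < K := by positivity
  have hratio := hlim.eventually ((hreg lam hlam).eventually (gt_mem_nhds (lt_add_one _)))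
  have hsmall : ∀ᶠ n in atTop, lam * (decayStep ψ)^[n] 1 < 1 := by
    have := (hlim.mono_right nhdsWithin_le_nhds).const_mul lam
    rw [mul_zero] at this
    exact this.eventually (gt_mem_nhds one_pos)
  have hlow : Tendsto (fun n : ℕ => 1 - (m n : ℝ) / n * (K * C)) atTop (𝓝 1) := by
    simpa using (hm.mul_const (K * C)).const_sub 1
  refine tendsto_of_tendsto_of_tendsto_of_le_of_le' hlow tendsto_const_nhds ?_ ?_
  · filter_upwards [hratio, hsmall, eventually_gt_atTop 0] with n hr hs hn
    set q := (decayStep ψ)^[n] 1 with hq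
    have hn' : (0 : ℝ) < n := by exact_mod_cast hn
    have hxm : x n ∈ Ioc (0 : ℝ) 1 := ⟨hx0 n, (hx n).trans hs.le⟩
    have hψ := hmono hxm ⟨mul_pos hlam (hmem n).1, hs.le⟩ (hx n)
    rw [div_lt_iff₀ (h0 _ (hmem n))] at hr
    have hle := le_decayStep_iterate hmono h0' h1 hxm (m n)
    rw [le_div_iff₀ (hx0 n), mul_comm]
    refine le_trans (mul_le_mul_of_nonneg_left ?_ (hx0 n).le) hle
    have hCn : ψ q ≤ C / n := by
      rw [le_div_iff₀ hn', mul_comm]; exact hC n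
    have : ψ (x n) ≤ K * (C / n) :=
      (hψ.trans hr.le).trans (mul_le_mul_of_nonneg_left hCn hK0.le)
    have := mul_le_mul_of_nonneg_left this (Nat.cast_nonneg (α := ℝ) (m n))
    calc 1 - (m n : ℝ) / n * (K * C) = 1 - m n * (K * (C / n)) := by ring
      _ ≤ _ := by linarith
  · filter_upwards [hsmall] with n hs
    have hxm : x n ∈ Ioc (0 : ℝ) 1 := ⟨hx0 n, (hx n).trans hs.le⟩
    exact div_le_one_of_le₀ (decayStep_iterate_mem h0' h1 hxm (m n)).2 (hx0 n).le

end Recursion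

section GeneratingFunction

open Set

variable {Ω : Type*} [MeasurableSpace Ω] {μ : Measure Ω}

/-- `E[∑_{j < X} (1 - x)^j]`, the quotient `(1 - E[(1 - x)^X]) / x` for `x ≠ 0`. -/
noncomputable def tailSum (μ : Measure Ω) (X : Ω → ℕ) (x : ℝ) : ℝ :=
  ∫ ω, ∑ j ∈ Finset.range (X ω), (1 - x) ^ j ∂μ

lemma integrable_tailSum {X : Ω → ℕ} (hX : Measurable X)
    (hint : Integrable (fun ω => (X ω : ℝ)) μ) {x : ℝ} (hx : x ∈ Icc (0 : ℝ) 1) :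
    Integrable (fun ω => ∑ j ∈ Finset.range (X ω), (1 - x) ^ j) μ := by
  have h : 0 ≤ 1 - x := by linarith [hx.2]
  refine hint.mono' ((measurable_from_nat
    (f := fun k => ∑ j ∈ Finset.range k, (1 - x) ^ j)).comp hX).aestronglyMeasurable
    (Eventually.of_forall fun ω => ?_)
  rw [Real.norm_of_nonneg (Finset.sum_nonneg fun j _ => pow_nonneg h j)]
  calc ∑ j ∈ Finset.range (X ω), (1 - x) ^ j ≤ ∑ j ∈ Finset.range (X ω), (1 : ℝ) :=
        Finset.sum_le_sum fun j _ => pow_le_one₀ h (by linarith [hx.1])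
    _ = X ω := by simp

lemma tailSum_antitoneOn {X : Ω → ℕ} (hX : Measurable X)
    (hint : Integrable (fun ω => (X ω : ℝ)) μ) : AntitoneOn (tailSum μ X) (Icc 0 1) := by
  intro x hx y hy hxy
  refine integral_mono (integrable_tailSum hX hint hy) (integrable_tailSum hX hint hx) fun ω => ?_
  exact Finset.sum_le_sum fun j _ => pow_le_pow_left₀ (by linarith [hy.2]) (by linarith) j

variable [IsProbabilityMeasure μ]

lemma integrable_pow_natCast {X : Ω → ℕ} (hX : Measurable X) {s : ℝ} (hs : s ∈ Icc (0 : ℝ) 1) :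
    Integrable (fun ω => s ^ X ω) μ := by
  refine Integrable.of_bound (C := 1)
    ((measurable_from_nat (f := fun k => s ^ k)).comp hX).aestronglyMeasurable
    (Eventually.of_forall fun ω => ?_)
  rw [Real.norm_of_nonneg (pow_nonneg hs.1 _)]
  exact pow_le_one₀ hs.1 hs.2

lemma one_sub_integral_zero_pow {X : Ω → ℕ} (hX : Measurable X) :
    1 - ∫ ω, (0 : ℝ) ^ X ω ∂μ = (μ {ω | X ω ≠ 0}).toReal := by
  have hms : MeasurableSet {ω | X ω = 0} := hX (measurableSet_singleton 0)
  have h : (fun ω => (0 : ℝ) ^ X ω) = {ω | X ω = 0}.indicator 1 := by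
    ext ω
    by_cases h : X ω = 0 <;> simp [h]
  rw [h, integral_indicator_one hms, ← probReal_compl_eq_one_sub hms]
  rfl

lemma one_sub_integral_pow {X : Ω → ℕ} (hX : Measurable X) {x : ℝ} (hx : x ∈ Icc (0 : ℝ) 1) :
    1 - ∫ ω, (1 - x) ^ X ω ∂μ = x * tailSum μ X x := by
  have hi := integrable_pow_natCast (μ := μ) hX (s := 1 - x)
    ⟨by linarith [hx.2], by linarith [hx.1]⟩
  have : (1 : ℝ) = ∫ _, (1 : ℝ) ∂μ := by simp
  rw [tailSum, ← integral_const_mul]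
  nth_rewrite 1 [this]
  rw [← integral_sub (integrable_const _) hi]
  congr 1
  ext ω
  have := mul_neg_geom_sum (1 - x) (X ω)
  rw [← this]; ring

lemma tailSum_pos {X : Ω → ℕ} (hX : Measurable X)
    (hmean : ∫ ω, (X ω : ℝ) ∂μ = 1) {x : ℝ} (hx : x ∈ Icc (0 : ℝ) 1) : 0 < tailSum μ X x := by
  have hint : Integrable (fun ω => (X ω : ℝ)) μ := by
    by_contra h
    rw [integral_undef h] at hmean
    exact zero_ne_one hmean
  refine lt_of_lt_of_le ?_ (tailSum_antitoneOn hX hint hx ⟨zero_le_one, le_rfl⟩ hx.2)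
  have h1 : tailSum μ X 1 = (μ {ω | X ω ≠ 0}).toReal := by
    have := one_sub_integral_pow (μ := μ) hX (x := 1) ⟨zero_le_one, le_rfl⟩
    rw [one_mul, sub_self, one_sub_integral_zero_pow hX] at this
    exact this.symm
  rw [h1]
  refine ENNReal.toReal_pos (fun h => ?_) (measure_ne_top _ _)
  have : (fun ω => (X ω : ℝ)) =ᵐ[μ] 0 := by
    have : ∀ᵐ ω ∂μ, X ω = 0 := h
    filter_upwards [this] with ω hω
    simp [hω]
  rw [integral_congr_ae this] at hmean
  simp at hmean

/-- A critical Galton–Watson process with regularly varying generating function, observed from a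
time scale `m n = o(n)` with arguments tuned to the survival probability at time `n`. -/
lemma asymp_one_sub_genFun {X : ℕ → Ω → ℕ} (hX : ∀ n, Measurable (X n)) {α : ℝ} (hα : 0 < α)
    {L : ℝ → ℝ} (hinit : ∀ᵐ ω ∂μ, X 0 ω = 1) (hmean : ∫ ω, (X 1 ω : ℝ) ∂μ = 1)
    (hF : ∀ s : ℝ, 0 ≤ s → s < 1 →
      ∫ ω, s ^ X 1 ω ∂μ = s + (1 - s) ^ (1 + α) * L (1 - s))
    (hL : ∀ c : ℝ, 0 < c → Tendsto (fun x => L (c * x) / L x) (𝓝[>] 0) (𝓝 1))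
    (hbranch : ∀ m n : ℕ, ∀ s : ℝ, 0 ≤ s → s ≤ 1 →
      ∫ ω, s ^ X (m + n) ω ∂μ = ∫ ω, (∫ ω', s ^ X n ω' ∂μ) ^ X m ω ∂μ)
    {m : ℕ → ℕ} (hm : Tendsto (fun n : ℕ => (m n : ℝ) / n) atTop (𝓝 0))
    {lam : ℝ} (hlam : 0 < lam) :
    Asymp (fun n => 1 - ∫ ω, Real.exp (-(lam * (μ {ω | X n ω ≠ 0}).toReal)) ^ X (m n) ω ∂μ)
        (fun n => lam * (μ {ω | X n ω ≠ 0}).toReal) ∧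
      Asymp (fun n => lam * (μ {ω | X n ω ≠ 0}).toReal)
        (fun n => 1 - ∫ ω, (1 - lam * (μ {ω | X n ω ≠ 0}).toReal) ^ X (m n) ω ∂μ) := by
  have hint : Integrable (fun ω => (X 1 ω : ℝ)) μ := by
    by_contra h
    rw [integral_undef h] at hmean
    exact zero_ne_one hmean
  have hsub : Ioc (0 : ℝ) 1 ⊆ Icc 0 1 := Ioc_subset_Icc_self
  set ψ : ℝ → ℝ := fun x => 1 - tailSum μ (X 1) x with hψ
  have hmono : MonotoneOn ψ (Ioc 0 1) := fun x hx y hy hxy => by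
    have := tailSum_antitoneOn (hX 1) hint (hsub hx) (hsub hy) hxy
    simp only [hψ]; linarith
  have h1 : ∀ x ∈ Ioc (0 : ℝ) 1, ψ x < 1 := fun x hx => by
    have := tailSum_pos (hX 1) hmean (hsub hx)
    simp only [hψ]; linarith
  have hnn : ∀ x ∈ Ioc (0 : ℝ) 1, 0 ≤ ψ x := fun x hx => by
    have := tailSum_antitoneOn (hX 1) hint ⟨le_rfl, zero_le_one⟩ (hsub hx) hx.1.le
    have hz : tailSum μ (X 1) 0 = 1 := by simpa [tailSum] using hmean
    simp only [hψ]; linarith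
  have hψL : ∀ x ∈ Ioc (0 : ℝ) 1, ψ x = x ^ α * L x := fun x hx => by
    have e1 := one_sub_integral_pow (μ := μ) (hX 1) (hsub hx)
    rw [hF (1 - x) (by linarith [hx.2]) (by linarith [hx.1]), sub_sub_cancel,
      Real.rpow_add hx.1, Real.rpow_one] at e1
    have : x * tailSum μ (X 1) x = x * (1 - x ^ α * L x) := by rw [← e1]; ring
    have := mul_left_cancel₀ hx.1.ne' this
    simp only [hψ, this]; ring
  have hnear : ∀ c : ℝ, 0 < c → ∀ᶠ x in 𝓝[>] (0 : ℝ), c * x ∈ Ioc (0 : ℝ) 1 := fun c hc => by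
    have hlt : ∀ᶠ x in 𝓝[>] (0 : ℝ), x < c⁻¹ :=
      nhdsWithin_le_nhds (gt_mem_nhds (inv_pos.2 hc))
    filter_upwards [self_mem_nhdsWithin, hlt] with x hx hx'
    refine ⟨mul_pos hc hx, ?_⟩
    calc c * x ≤ c * c⁻¹ := by gcongr
      _ = 1 := mul_inv_cancel₀ hc.ne'
  have h0 : ∀ x ∈ Ioc (0 : ℝ) 1, 0 < ψ x := fun x hx => by
    have hne : ∀ᶠ y in 𝓝[>] (0 : ℝ), L y ≠ 0 := by
      filter_upwards [(hL 1 one_pos).eventually (lt_mem_nhds one_pos)] with y hy h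
      simp [h] at hy
    have hlt : ∀ᶠ y in 𝓝[>] (0 : ℝ), y < x := nhdsWithin_le_nhds (gt_mem_nhds hx.1)
    obtain ⟨y, hy, hyx, hy0⟩ := (hne.and (hlt.and self_mem_nhdsWithin)).exists
    have hy1 : y ∈ Ioc (0 : ℝ) 1 := ⟨hy0, hyx.le.trans hx.2⟩
    have hyψ : ψ y ≠ 0 := by
      rw [hψL y hy1]
      exact mul_ne_zero (Real.rpow_pos_of_pos hy0 _).ne' hy
    exact ((hnn y hy1).lt_of_ne' hyψ).trans_le (hmono hy1 hx hyx.le)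
  have hreg : ∀ c : ℝ, 0 < c →
      Tendsto (fun x => ψ (c * x) / ψ x) (𝓝[>] 0) (𝓝 (c ^ α)) := fun c hc => by
    have := (hL c hc).const_mul (c ^ α)
    rw [mul_one] at this
    refine this.congr' ?_
    filter_upwards [hnear c hc, hnear 1 one_pos, self_mem_nhdsWithin] with x hcx hx hx0
    rw [one_mul] at hx
    have hxα : x ^ α ≠ 0 := (Real.rpow_pos_of_pos hx0 _).ne'
    rw [hψL _ hcx, hψL _ hx, Real.mul_rpow hc.le hx.1.le, mul_assoc, mul_div_assoc,
      mul_div_mul_left _ _ hxα]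
  have one_mem : (1 : ℝ) ∈ Ioc (0 : ℝ) 1 := by simp
  have hiter : ∀ (k : ℕ) (x : ℝ), x ∈ Ioc (0 : ℝ) 1 →
      1 - ∫ ω, (1 - x) ^ X k ω ∂μ = (decayStep ψ)^[k] x := fun k x hx => by
    induction k with
    | zero =>
      have : ∫ ω, (1 - x) ^ X 0 ω ∂μ = ∫ _, (1 - x) ∂μ := by
        refine integral_congr_ae ?_
        filter_upwards [hinit] with ω hω
        rw [hω, pow_one]
      rw [this]; simp
    | succ k ih =>
      rw [Function.iterate_succ_apply', add_comm,
        hbranch 1 k _ (by linarith [hx.2]) (by linarith [hx.1])]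
      have hk := (decayStep_iterate_mem hnn h1 hx k).1
      rw [show ∫ ω, (1 - x) ^ X k ω ∂μ = 1 - (decayStep ψ)^[k] x by linarith,
        one_sub_integral_pow (hX 1) (hsub hk)]
      simp [decayStep, hψ]
  have hq : ∀ n, (μ {ω | X n ω ≠ 0}).toReal = (decayStep ψ)^[n] 1 := fun n => by
    rw [← hiter n 1 one_mem, sub_self, one_sub_integral_zero_pow (hX n)]
  simp only [hq]
  have hmem := fun n => (decayStep_iterate_mem hnn h1 one_mem n).1
  have hlim := tendsto_decayStep_iterate hmono h0 h1
  have hxpos : ∀ n, 0 < lam * (decayStep ψ)^[n] 1 := fun n => mul_pos hlam (hmem n).1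
  have hx0 : Tendsto (fun n => lam * (decayStep ψ)^[n] 1) atTop (𝓝 0) := by
    simpa using (hlim.mono_right nhdsWithin_le_nhds).const_mul lam
  constructor
  · have hypos : ∀ n, 0 < 1 - Real.exp (-(lam * (decayStep ψ)^[n] 1)) := fun n => by
      have := Real.exp_lt_exp.2 (neg_lt_zero.2 (hxpos n))
      rw [Real.exp_zero] at this
      linarith
    have hyle : ∀ n, 1 - Real.exp (-(lam * (decayStep ψ)^[n] 1)) ≤ lam * (decayStep ψ)^[n] 1 :=
      fun n => by linarith [Real.add_one_le_exp (-(lam * (decayStep ψ)^[n] 1))]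
    have hmain := tendsto_decayStep_iterate_div hα hmono h0 h1 hreg hm hlam hypos hyle
    have hquot : Tendsto (fun n => (1 - Real.exp (-(lam * (decayStep ψ)^[n] 1))) /
        (lam * (decayStep ψ)^[n] 1)) atTop (𝓝 1) := by
      have hlow : Tendsto (fun n => Real.exp (-(lam * (decayStep ψ)^[n] 1))) atTop (𝓝 1) := by
        simpa [Function.comp_def] using (Real.continuous_exp.tendsto _).comp hx0.neg
      refine tendsto_of_tendsto_of_tendsto_of_le_of_le hlow tendsto_const_nhds
        (fun n => ?_) fun n => div_le_one_of_le₀ (hyle n) (hxpos n).le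
      set u := lam * (decayStep ψ)^[n] 1
      change Real.exp (-u) ≤ (1 - Real.exp (-u)) / u
      rw [le_div_iff₀ (hxpos n)]
      have h : Real.exp (-u) * (u + 1) ≤ Real.exp (-u) * Real.exp u := by
        gcongr
        exact Real.add_one_le_exp u
      rw [← Real.exp_add, neg_add_cancel, Real.exp_zero] at h
      linarith
    have := hmain.mul hquot
    rw [mul_one] at this
    refine this.congr fun n => ?_
    have h := hiter (m n) _ ⟨hypos n, by linarith [Real.exp_pos (-(lam * (decayStep ψ)^[n] 1))]⟩
    rw [sub_sub_cancel] at h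
    simp only [h]
    rw [div_mul_div_cancel₀ (hypos n).ne']
  · have hmain := (tendsto_decayStep_iterate_div hα hmono h0 h1 hreg hm hlam hxpos
      fun n => le_rfl).inv₀ one_ne_zero
    rw [inv_one] at hmain
    refine hmain.congr' ?_
    filter_upwards [hx0.eventually (gt_mem_nhds one_pos)] with n hn
    rw [hiter (m n) _ ⟨hxpos n, hn.le⟩, inv_div]

end GeneratingFunction

/-- Lemma `L_trick`.  For `i ∈ {1,2}`, a sequence `m(n)` of
nonnegative integers with `m(n)/n → 0` and `λ > 0`,
`Q_i(m(n); e^{-λ Q_i(n)}) ~ λ Q_i(n) ~ Q_i(m(n); 1 - λ Q_i(n))`. -/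
theorem trick_lemma (S : GWSetup) (i : ℕ) (hi : i = 1 ∨ i = 2)
    (m : ℕ → ℕ)
    (hmn : Filter.Tendsto (fun n : ℕ => (m n : ℝ) / (n : ℝ)) Filter.atTop (nhds 0))
    (lam : ℝ) (hlam : 0 < lam) :
    Asymp
      (fun n : ℕ =>
        if i = 1 then S.Q1s (m n) (Real.exp (-(lam * S.Q1 n)))
        else S.Q2s (m n) (Real.exp (-(lam * S.Q2 n))))
      (fun n : ℕ => lam * (if i = 1 then S.Q1 n else S.Q2 n)) ∧
    Asymp
      (fun n : ℕ => lam * (if i = 1 then S.Q1 n else S.Q2 n))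
      (fun n : ℕ =>
        if i = 1 then S.Q1s (m n) (1 - lam * S.Q1 n)
        else S.Q2s (m n) (1 - lam * S.Q2 n)) := by
  let _ := S.mΩ
  have := S.hprob1
  have := S.hprob2
  rcases hi with rfl | rfl
  · simp only [if_true]
    exact asymp_one_sub_genFun S.mZ1 S.hα1.1 (S.hinit1.mono fun ω h => h.1) S.hcrit1 S.hF1 S.hL1
      S.hbranch1 hmn hlam
  · simp only [OfNat.ofNat_ne_one, if_false, GWSetup.Q2s, GWSetup.F21, one_pow, one_mul]
    refine asymp_one_sub_genFun S.mZ2 S.hα2.1 (S.hinit2.mono fun ω h => h.2) S.hcrit2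
      (fun s h0 h1 => ?_) S.hL2 (fun k n s h0 h1 => ?_) hmn hlam
    · simpa using S.hF2 1 s zero_le_one le_rfl h0 h1
    · simpa using S.hbranch2 k n 1 s zero_le_one le_rfl h0 h1
end
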